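/- For every real c with 1/12 < c < 1/11, set a = 1 − 10c + 2√(12c² − c) and b = 2c − √(12c² − c). Then the 9×9 diagonal matrix diag(a, b, b, c, c, c, c, c, c) is an extreme point of AP_{3,3}. -/

import Mathlib

open Matrix ComplexOrder

noncomputable section

/-- Index type for a two-qutrit system. -/
abbrev QIdx : Type := Fin 3 × Fin 3

/-- Partial transpose: `PT M ((i,j),(k,l)) = M ((i,l),(k,j))`. -/
def PT (M : Matrix QIdx QIdx ℂ) : Matrix QIdx QIdx ℂ :=
  fun p q => M (p.1, q.2) (q.1, p.2)

/-- The set of absolutely PPT two-qutrit states. -/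
def AP33 : Set (Matrix QIdx QIdx ℂ) :=
  {ρ | ρ.PosSemidef ∧ ρ.trace = 1 ∧
    ∀ U : Matrix QIdx QIdx ℂ, U ∈ Matrix.unitaryGroup QIdx ℂ →
      (PT (U * ρ * Uᴴ)).PosSemidef}

/-- The 9×9 diagonal matrix with prescribed real diagonal entries
(listed in order), regarded as a matrix indexed by `QIdx`. -/
def diag9 (d : Fin 9 → ℝ) : Matrix QIdx QIdx ℂ :=
  Matrix.diagonal fun p => ((d ((finProdFinEquiv.trans (finCongr (by norm_num))) p) : ℝ) : ℂ)

/-! ### Singular value decomposition -/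

/-- Singular value decomposition of a square complex matrix. -/
lemma exists_singular_value_decomposition {n : Type*} [Fintype n] [DecidableEq n] [LinearOrder n]
    [LocallyFiniteOrderBot n] [WellFoundedLT n] (A : Matrix n n ℂ) :
    ∃ V ∈ unitaryGroup n ℂ, ∃ W ∈ unitaryGroup n ℂ, ∃ s : n → ℝ, (∀ i, 0 ≤ s i) ∧
      A = V * diagonal (fun i => (s i : ℂ)) * Wᴴ := by
  have hA : (Aᴴ * A).IsHermitian := isHermitian_conjTranspose_mul_self A
  set W : Matrix n n ℂ := (hA.eigenvectorUnitary : Matrix n n ℂ) with hW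
  have hWu : W ∈ unitaryGroup n ℂ := hA.eigenvectorUnitary.2
  have hWW : W * Wᴴ = 1 := mem_unitaryGroup_iff.1 hWu
  have hD : (A * W)ᴴ * (A * W) = diagonal (fun i => (hA.eigenvalues i : ℂ)) := by
    have h := hA.conjStarAlgAut_star_eigenvectorUnitary
    rw [Unitary.conjStarAlgAut_apply, Unitary.coe_star, ← hW, star_star] at h
    rw [conjTranspose_mul, Matrix.mul_assoc, ← Matrix.mul_assoc Aᴴ, ← Matrix.mul_assoc]
    exact h
  let f : n → EuclideanSpace ℂ n := fun j => WithLp.toLp 2 fun i => (A * W) i j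
  have hf : Pairwise fun i j => inner ℂ (f i) (f j) = 0 := by
    intro i j hij
    have h := congrFun (congrFun hD i) j
    rw [diagonal_apply_ne _ hij] at h
    rw [← h, PiLp.inner_apply, mul_apply]
    exact Finset.sum_congr rfl fun k _ => mul_comm _ _
  let b := InnerProductSpace.gramSchmidtOrthonormalBasis (𝕜 := ℂ) (by simp) f
  have hb : ∀ j, f j = ((‖f j‖ : ℝ) : ℂ) • b j := by
    intro j
    by_cases hj : f j = 0
    · simp [hj]
    · have : b j = _ := InnerProductSpace.gramSchmidtOrthonormalBasis_apply_of_orthogonal _ hf hj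
      rw [this, smul_smul]
      have : ((‖f j‖ : ℝ) : ℂ) ≠ 0 := by simpa using hj
      simp [this]
  refine ⟨Matrix.of fun i j => b j i, ?_, W, hWu, fun j => ‖f j‖, fun j => norm_nonneg _, ?_⟩
  · rw [mem_unitaryGroup_iff']
    ext i j
    have h := orthonormal_iff_ite.1 b.orthonormal i j
    rw [PiLp.inner_apply] at h
    simp only [star_eq_conjTranspose, mul_apply, conjTranspose_apply, of_apply, one_apply]
    rw [← h]
    simp [mul_comm]
  · have h : A * W = (Matrix.of fun i j => b j i) * diagonal (fun j => ((‖f j‖ : ℝ) : ℂ)) := by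
      ext i j
      have h := congrArg (fun v : EuclideanSpace ℂ n => v i) (hb j)
      simp only [mul_diagonal, of_apply]
      simpa [f, mul_comm] using h
    rw [← h, Matrix.mul_assoc, hWW, Matrix.mul_one]

/-! ### The partial transpose -/

lemma PT_isHermitian {M : Matrix QIdx QIdx ℂ} (hM : M.IsHermitian) : (PT M).IsHermitian := by
  ext p q
  exact hM.apply _ _

/-- A local unitary conjugation passes through the partial transpose, with the second factor
replaced by its entrywise conjugate. -/
lemma PT_kronecker_conj (N : Matrix QIdx QIdx ℂ) (V W : Matrix (Fin 3) (Fin 3) ℂ) :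
    PT ((kroneckerMap (· * ·) V W)ᴴ * N * kroneckerMap (· * ·) V W) =
      (kroneckerMap (· * ·) V (W.map star))ᴴ * PT N * kroneckerMap (· * ·) V (W.map star) := by
  ext ⟨p, q⟩ ⟨p', q'⟩
  simp only [PT, mul_apply, conjTranspose_apply, kroneckerMap_apply, Fintype.sum_prod_type,
    map_apply, Finset.sum_mul, star_mul', star_star]
  refine Finset.sum_congr rfl fun k _ => ?_
  rw [Finset.sum_comm' (t' := Finset.univ) (s' := fun _ => Finset.univ) (by simp)]
  conv_rhs => rw [Finset.sum_comm' (t' := Finset.univ) (s' := fun _ => Finset.univ) (by simp)]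
  refine Finset.sum_congr rfl fun i _ => ?_
  rw [Finset.sum_comm' (t' := Finset.univ) (s' := fun _ => Finset.univ) (by simp)]
  refine Finset.sum_congr rfl fun l _ => Finset.sum_congr rfl fun j _ => ?_
  ring

/-- The quadratic form of a partial transpose at a vector `x`, in terms of a singular value
decomposition `V * diagonal s * Wᴴ` of `x` viewed as a matrix. -/
lemma dotProduct_PT_mulVec (N : Matrix QIdx QIdx ℂ) (V W : Matrix (Fin 3) (Fin 3) ℂ)
    (s : Fin 3 → ℝ) (x : QIdx → ℂ)
    (hx : ∀ i j, x (i, j) = (V * diagonal (fun i => (s i : ℂ)) * Wᴴ) i j) :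
    star x ⬝ᵥ (PT N *ᵥ x) = ∑ p, ∑ q, (s p : ℂ) * s q *
      ((kroneckerMap (· * ·) V W)ᴴ * N * kroneckerMap (· * ·) V W) (p, q) (q, p) := by
  have hx' : x = kroneckerMap (· * ·) V (W.map star) *ᵥ
      fun p : QIdx => if p.1 = p.2 then (s p.1 : ℂ) else 0 := by
    ext ⟨i, j⟩
    simp only [hx, mulVec, dotProduct, Fintype.sum_prod_type, kroneckerMap_apply, map_apply,
      mul_ite, mul_zero, Finset.sum_ite_eq, Finset.mem_univ, if_true]
    simp only [mul_apply (N := Wᴴ), mul_diagonal, conjTranspose_apply]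
    exact Finset.sum_congr rfl fun p _ => by ring
  rw [hx', star_mulVec, ← dotProduct_mulVec, mulVec_mulVec, mulVec_mulVec,
    ← PT_kronecker_conj]
  simp only [dotProduct, mulVec, Fintype.sum_prod_type, Pi.star_apply, PT, mul_ite, mul_zero,
    Finset.sum_ite_eq, Finset.mem_univ, if_true, apply_ite star, star_zero, ite_mul, zero_mul]
  refine Finset.sum_congr rfl fun p _ => ?_
  rw [Finset.mul_sum]
  refine Finset.sum_congr rfl fun q _ => ?_
  simp only [RCLike.star_def, Complex.conj_ofReal]
  ring

/-! ### The spectrum -/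

/-- The spectrum `(c (3 - t²), c (1 + t), c (1 + t), c, c, c, c, c, c)`. -/
def nu (c t : ℝ) (p : QIdx) : ℝ :=
  if p = (0, 0) then c * (3 - t ^ 2) else if p.1 = 0 then c * (1 + t) else c

/-- A polynomial inequality behind absolute positivity of the partial transpose. -/
lemma weighted_sum_nonneg {t x y z u v w : ℝ} (ht0 : 0 ≤ t) (ht1 : t ≤ 1)
    (hx : 0 ≤ x) (hy : 0 ≤ y) (hu : 0 ≤ u) (hv : 0 ≤ v) (hw : 0 ≤ w)
    (huvw : u + v + w ≤ 1) :
    0 ≤ x ^ 2 + y ^ 2 + z ^ 2 - t * (x * y + x * z + y * z) -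
      (2 - t - t ^ 2) * (x * y * u + x * z * v + y * z * w) := by
  have key : ∀ a b d : ℝ, 0 ≤ a ^ 2 + b ^ 2 + d ^ 2 - t * (a * b + a * d + b * d) -
      (2 - t - t ^ 2) * (a * b) := by
    intro a b d
    have h : 0 ≤ (1 - t ^ 2 / 4) * (a - b) ^ 2 :=
      mul_nonneg (by nlinarith) (sq_nonneg _)
    nlinarith [sq_nonneg (d - t * (a + b) / 2)]
  have h0 : 0 ≤ x ^ 2 + y ^ 2 + z ^ 2 - t * (x * y + x * z + y * z) := by
    have : 0 ≤ (2 - t - t ^ 2) * (x * y) := mul_nonneg (by nlinarith) (mul_nonneg hx hy)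
    linarith [key x y z]
  have h1 := mul_nonneg hu (key x y z)
  have h2 := mul_nonneg hv (key x z y)
  have h3 := mul_nonneg hw (key y z x)
  have h4 := mul_nonneg (sub_nonneg.2 huvw) h0
  nlinarith

lemma re_mul_star_ge (z w : ℂ) :
    -(Complex.normSq (z - w) / 2) ≤ (z * star w).re + (w * star z).re := by
  simp only [Complex.normSq_apply, Complex.sub_re, Complex.sub_im, Complex.mul_re,
    RCLike.star_def, Complex.conj_re, Complex.conj_im]
  nlinarith [sq_nonneg (z.re + w.re), sq_nonneg (z.im + w.im)]

/-- For nonnegative Schmidt coefficients, the form `∑ s p s q (U ρ Uᴴ) (p, q) (q, p)` is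
nonnegative. -/
lemma sum_swap_re_nonneg {c t : ℝ} (hc : 0 ≤ c) (ht0 : 0 ≤ t) (ht1 : t ≤ 1)
    {U : Matrix QIdx QIdx ℂ} (hU : U ∈ unitaryGroup QIdx ℂ) {s : Fin 3 → ℝ} (hs : ∀ i, 0 ≤ s i) :
    0 ≤ (∑ p, ∑ q, (s p : ℂ) * s q *
      (U * diagonal (fun m => (nu c t m : ℂ)) * Uᴴ) (p, q) (q, p)).re := by
  have hrow : ∀ a b : QIdx, ∑ m, U a m * star (U b m) = if a = b then 1 else 0 := by
    intro a b
    have h := congrFun (congrFun (mem_unitaryGroup_iff.1 hU) a) b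
    simpa [mul_apply, one_apply] using h
  have hcol : ∀ m, ∑ a, Complex.normSq (U a m) = 1 := by
    intro m
    have h := congrFun (congrFun (mem_unitaryGroup_iff'.1 hU) m) m
    have h' := congrArg Complex.re h
    simpa [mul_apply, Complex.normSq_apply] using h'
  set e : QIdx → QIdx → QIdx → ℝ := fun a b m => (U a m * star (U b m)).re with he
  set g : QIdx → QIdx → QIdx → ℝ := fun a b m => Complex.normSq (U a m - U b m) / 2 with hg
  have hg0 : ∀ a b m, 0 ≤ g a b m := fun a b m => div_nonneg (Complex.normSq_nonneg _) (by norm_num)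
  have he_sum : ∀ a b, ∑ m, e a b m = if a = b then 1 else 0 := by
    intro a b
    have h := congrArg Complex.re (hrow a b)
    rw [Complex.re_sum] at h
    rw [h]
    split_ifs <;> simp
  have hge : ∀ a b m, g a b m = (e a a m + e b b m - e a b m - e b a m) / 2 := by
    intro a b m
    simp only [he, hg, Complex.normSq_apply, Complex.sub_re, Complex.sub_im, Complex.mul_re,
      RCLike.star_def, Complex.conj_re, Complex.conj_im]
    ring
  have hg_sum : ∀ a b, a ≠ b → ∑ m, g a b m = 1 := by
    intro a b hab
    simp only [hge, ← Finset.sum_div, Finset.sum_sub_distrib, Finset.sum_add_distrib, he_sum]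
    simp [hab, hab.symm]
  have hg_top : ∀ a b, a ≠ b → g a b (0, 0) + g a b (0, 1) + g a b (0, 2) ≤ 1 := by
    intro a b hab
    have h := hg_sum a b hab
    simp only [Fintype.sum_prod_type, Fin.sum_univ_three] at h
    linarith [hg0 a b (1, 0), hg0 a b (1, 1), hg0 a b (1, 2), hg0 a b (2, 0), hg0 a b (2, 1),
      hg0 a b (2, 2)]
  have hg_le : ∀ a b m, g a b m ≤ Complex.normSq (U a m) + Complex.normSq (U b m) := by
    intro a b m
    simp only [hg, Complex.normSq_apply, Complex.sub_re, Complex.sub_im]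
    nlinarith [sq_nonneg ((U a m).re + (U b m).re), sq_nonneg ((U a m).im + (U b m).im)]
  have hg_col : g (0, 1) (1, 0) (0, 0) + g (0, 2) (2, 0) (0, 0) + g (1, 2) (2, 1) (0, 0) ≤ 1 := by
    have h := hcol (0, 0)
    simp only [Fintype.sum_prod_type, Fin.sum_univ_three] at h
    linarith [hg_le (0, 1) (1, 0) (0, 0), hg_le (0, 2) (2, 0) (0, 0), hg_le (1, 2) (2, 1) (0, 0),
      Complex.normSq_nonneg (U (0, 0) (0, 0)), Complex.normSq_nonneg (U (1, 1) (0, 0)),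
      Complex.normSq_nonneg (U (2, 2) (0, 0))]
  set R : QIdx → QIdx → ℝ := fun a b =>
    c * (2 - t ^ 2) * e a b (0, 0) + c * t * (e a b (0, 1) + e a b (0, 2)) with hR
  have hentry : ∀ a b, ((U * diagonal (fun m => (nu c t m : ℂ)) * Uᴴ) a b).re =
      c * (if a = b then 1 else 0) + R a b := by
    intro a b
    have h1 : ((U * diagonal (fun m => (nu c t m : ℂ)) * Uᴴ) a b).re = ∑ m, nu c t m * e a b m := by
      rw [mul_apply, Complex.re_sum]
      refine Finset.sum_congr rfl fun m _ => ?_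
      rw [mul_diagonal, conjTranspose_apply, mul_right_comm, mul_comm, Complex.re_ofReal_mul]
    rw [h1, ← he_sum]
    simp only [Fintype.sum_prod_type, Fin.sum_univ_three, nu, hR]
    simp
    ring
  have hRdiag : ∀ a, 0 ≤ R a a := by
    intro a
    have h : ∀ m, 0 ≤ e a a m := fun m => by
      simp only [he, Complex.mul_re, RCLike.star_def, Complex.conj_re, Complex.conj_im]
      nlinarith [sq_nonneg (U a m).re, sq_nonneg (U a m).im]
    have h2 : 0 ≤ 2 - t ^ 2 := by nlinarith
    have := h (0, 0)
    have := h (0, 1)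
    have := h (0, 2)
    simp only [hR]
    positivity
  have hRoff : ∀ a b, a ≠ b → -(c * t + c * (2 - t - t ^ 2) * g a b (0, 0)) ≤ R a b + R b a := by
    intro a b hab
    have h : ∀ m, -g a b m ≤ e a b m + e b a m := fun m => re_mul_star_ge _ _
    have h2 : 0 ≤ c * (2 - t ^ 2) := mul_nonneg hc (by nlinarith)
    have h3 : 0 ≤ c * t := mul_nonneg hc ht0
    have h4 := mul_le_mul_of_nonneg_left (h (0, 0)) h2
    have h5 := mul_le_mul_of_nonneg_left (h (0, 1)) h3
    have h6 := mul_le_mul_of_nonneg_left (h (0, 2)) h3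
    have h7 := mul_le_mul_of_nonneg_left (hg_top a b hab) h3
    simp only [hR]
    linarith
  have hre : (∑ p, ∑ q, (s p : ℂ) * s q *
      (U * diagonal (fun m => (nu c t m : ℂ)) * Uᴴ) (p, q) (q, p)).re =
      ∑ p, ∑ q, s p * s q * (c * (if p = q then 1 else 0) + R (p, q) (q, p)) := by
    simp only [Complex.re_sum]
    refine Finset.sum_congr rfl fun p _ => Finset.sum_congr rfl fun q _ => ?_
    rw [← Complex.ofReal_mul, Complex.re_ofReal_mul, hentry]
    by_cases hpq : p = q <;> simp [hpq]
  rw [hre]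
  simp only [Fin.sum_univ_three]
  have q0 := mul_nonneg (mul_nonneg (hs 0) (hs 0)) (hRdiag (0, 0))
  have q1 := mul_nonneg (mul_nonneg (hs 1) (hs 1)) (hRdiag (1, 1))
  have q2 := mul_nonneg (mul_nonneg (hs 2) (hs 2)) (hRdiag (2, 2))
  have q3 := mul_le_mul_of_nonneg_left (hRoff (0, 1) (1, 0) (by simp)) (mul_nonneg (hs 0) (hs 1))
  have q4 := mul_le_mul_of_nonneg_left (hRoff (0, 2) (2, 0) (by simp)) (mul_nonneg (hs 0) (hs 2))
  have q5 := mul_le_mul_of_nonneg_left (hRoff (1, 2) (2, 1) (by simp)) (mul_nonneg (hs 1) (hs 2))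
  have q6 := mul_nonneg hc (weighted_sum_nonneg (z := s 2) ht0 ht1 (hs 0) (hs 1)
    (hg0 (0, 1) (1, 0) (0, 0)) (hg0 (0, 2) (2, 0) (0, 0)) (hg0 (1, 2) (2, 1) (0, 0)) hg_col)
  simp
  linarith

/-- The states with spectrum `nu c t` are absolutely PPT. -/
lemma diagonal_nu_mem_AP33 {c t : ℝ} (hc : 0 ≤ c) (ht0 : 0 ≤ t) (ht1 : t ≤ 1)
    (htr : c * (11 + 2 * t - t ^ 2) = 1) :
    (diagonal (fun m => (nu c t m : ℂ)) : Matrix QIdx QIdx ℂ) ∈ AP33 := by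
  have hpsd : (diagonal (fun m => (nu c t m : ℂ)) : Matrix QIdx QIdx ℂ).PosSemidef := by
    refine PosSemidef.diagonal fun m => ?_
    have h : 0 ≤ nu c t m := by
      unfold nu
      split_ifs
      · exact mul_nonneg hc (by nlinarith)
      · positivity
      · exact hc
    exact Complex.zero_le_real.2 h
  refine ⟨hpsd, ?_, fun U hU => ?_⟩
  · rw [trace_diagonal]
    have h : ∑ m, nu c t m = 1 := by
      simp only [Fintype.sum_prod_type, Fin.sum_univ_three, nu]
      simp
      linarith
    exact_mod_cast h
  · have hherm : (PT (U * diagonal (fun m => (nu c t m : ℂ)) * Uᴴ)).IsHermitian :=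
      PT_isHermitian (isHermitian_mul_mul_conjTranspose U hpsd.isHermitian)
    refine PosSemidef.of_dotProduct_mulVec_nonneg hherm fun x => ?_
    obtain ⟨V, hV, W, hW, s, hs, hx⟩ :=
      exists_singular_value_decomposition (Matrix.of fun i j => x (i, j))
    have hQ : kroneckerMap (· * ·) V W ∈ unitaryGroup QIdx ℂ := kronecker_mem_unitary hV hW
    have hnn := sum_swap_re_nonneg hc ht0 ht1
      (mul_mem (Unitary.star_mem hQ) hU : _ ∈ unitaryGroup QIdx ℂ) hs
    refine Complex.nonneg_iff.2 ⟨?_, (hherm.im_star_dotProduct_mulVec_self x).symm⟩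
    rw [dotProduct_PT_mulVec _ V W s x fun i j => congrFun (congrFun hx i) j]
    simpa [star_eq_conjTranspose, conjTranspose_mul, Matrix.mul_assoc] using hnn

/-! ### An extremal unitary -/

/-- A unitary matrix whose columns are, in this order, the antisymmetric vectors, the symmetric
vectors and the product vectors built from the standard basis of `ℂ³`. -/
def symmetryBasis : Matrix QIdx QIdx ℂ := fun a m =>
  let P : Fin 3 → Fin 3 := ![0, 0, 1]
  let Q : Fin 3 → Fin 3 := ![1, 2, 2]
  let r : ℂ := ((√2)⁻¹ : ℝ)
  if m.1 = 2 then (if a.1 = m.2 ∧ a.2 = m.2 then 1 else 0)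
  else if a.1 = P m.2 ∧ a.2 = Q m.2 then r
  else if a.1 = Q m.2 ∧ a.2 = P m.2 then (if m.1 = 0 then -r else r) else 0

lemma inv_sqrt_two_mul_self : (((√2)⁻¹ : ℝ) : ℂ) * (((√2)⁻¹ : ℝ) : ℂ) = 1 / 2 := by
  rw [← Complex.ofReal_mul, ← mul_inv, Real.mul_self_sqrt (by norm_num)]
  norm_num

lemma star_symmetryBasis (a m : QIdx) : star (symmetryBasis a m) = symmetryBasis a m := by
  simp only [symmetryBasis]
  split_ifs <;> simp

lemma symmetryBasis_mem_unitaryGroup : symmetryBasis ∈ unitaryGroup QIdx ℂ := by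
  rw [mem_unitaryGroup_iff]
  ext ⟨i, j⟩ ⟨k, l⟩
  have h := inv_sqrt_two_mul_self
  simp only [star_eq_conjTranspose, mul_apply, conjTranspose_apply, star_symmetryBasis]
  simp only [symmetryBasis, Fintype.sum_prod_type, Fin.sum_univ_three]
  generalize (((√2)⁻¹ : ℝ) : ℂ) = r at h
  fin_cases i <;> fin_cases j <;> fin_cases k <;> fin_cases l <;> simp [h] <;> norm_num

/-- The vector `|00⟩ + |11⟩ + t |22⟩`. -/
def schmidtVec (t : ℝ) (p : QIdx) : ℂ :=
  if p.1 = p.2 then (![1, 1, (t : ℂ)] p.1) else 0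

lemma PT_symmetryBasis_mulVec (t : ℝ) (Z : Matrix QIdx QIdx ℂ) (i j : Fin 3) :
    (PT (symmetryBasis * Z * symmetryBasisᴴ) *ᵥ schmidtVec t) (i, j) =
      ∑ m, ∑ n, Z m n * ∑ k, ![1, 1, (t : ℂ)] k * symmetryBasis (i, k) m *
        symmetryBasis (k, j) n := by
  simp only [mulVec, dotProduct]
  rw [Fintype.sum_prod_type]
  simp only [schmidtVec, mul_ite, mul_zero, Finset.sum_ite_eq, Finset.mem_univ, if_true, PT,
    mul_apply, conjTranspose_apply, star_symmetryBasis, Finset.sum_mul, Finset.mul_sum]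
  rw [Finset.sum_comm]
  conv_lhs => enter [2, n]; rw [Finset.sum_comm]
  rw [Finset.sum_comm]
  refine Finset.sum_congr rfl fun m _ => Finset.sum_congr rfl fun n _ =>
    Finset.sum_congr rfl fun k _ => ?_
  ring

lemma PT_symmetryBasis_diagonal_mulVec (t : ℝ) (z : QIdx → ℂ) (i j : Fin 3) :
    (PT (symmetryBasis * diagonal z * symmetryBasisᴴ) *ᵥ schmidtVec t) (i, j) =
      ∑ m, z m * ∑ k, ![1, 1, (t : ℂ)] k * symmetryBasis (i, k) m * symmetryBasis (k, j) m := by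
  rw [PT_symmetryBasis_mulVec]
  refine Finset.sum_congr rfl fun m _ => ?_
  rw [Finset.sum_eq_single m (fun n _ h => by simp [diagonal_apply_ne _ h.symm]) (by simp),
    diagonal_apply_eq]

lemma PT_symmetryBasis_single_mulVec (t : ℝ) (m n : QIdx) (z : ℂ) (i j : Fin 3) :
    (PT (symmetryBasis * single m n z * symmetryBasisᴴ) *ᵥ schmidtVec t) (i, j) =
      z * ∑ k, ![1, 1, (t : ℂ)] k * symmetryBasis (i, k) m * symmetryBasis (k, j) n := by
  rw [PT_symmetryBasis_mulVec, Finset.sum_eq_single m, Finset.sum_eq_single n]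
  · simp
  · intro b _ hb
    simp [hb.symm]
  · simp
  · intro b _ hb
    simp [hb.symm]
  · simp

lemma PT_symmetryBasis_nu_mulVec (c t : ℝ) :
    PT (symmetryBasis * diagonal (fun m => (nu c t m : ℂ)) * symmetryBasisᴴ) *ᵥ schmidtVec t
      = 0 := by
  ext ⟨i, j⟩
  rw [PT_symmetryBasis_diagonal_mulVec]
  have h := inv_sqrt_two_mul_self
  simp only [symmetryBasis, Fintype.sum_prod_type, Fin.sum_univ_three, nu]
  generalize (((√2)⁻¹ : ℝ) : ℂ) = r at h
  fin_cases i <;> fin_cases j <;> simp [mul_assoc, h] <;> ring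

/-! ### Linear conditions satisfied by the members of a segment through the state -/

/-- The linear conditions on `Z` coming from all unitaries that fix the state with spectrum
`nu c t`. -/
def IsAnnihilated (c t : ℝ) (Z : Matrix QIdx QIdx ℂ) : Prop :=
  ∀ V ∈ unitaryGroup QIdx ℂ,
    V * diagonal (fun m => (nu c t m : ℂ)) * Vᴴ = diagonal (fun m => (nu c t m : ℂ)) →
    PT (symmetryBasis * (V * Z * Vᴴ) * symmetryBasisᴴ) *ᵥ schmidtVec t = 0

/-- Two positive semidefinite matrices with a positive combination killing `x` both kill `x`. -/
lemma mulVec_eq_zero_of_posSemidef_add {n : Type*} [Fintype n] {A B : Matrix n n ℂ} {α β : ℝ}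
    (hA : A.PosSemidef) (hB : B.PosSemidef) (hα : 0 < α) (hβ : 0 ≤ β) {x : n → ℂ}
    (h : (α • A + β • B) *ᵥ x = 0) : A *ᵥ x = 0 := by
  have hA' := hA.dotProduct_mulVec_nonneg x
  have hB' := hB.dotProduct_mulVec_nonneg x
  have h0 : α • (star x ⬝ᵥ (A *ᵥ x)) + β • (star x ⬝ᵥ (B *ᵥ x)) = 0 := by
    rw [← dotProduct_smul, ← dotProduct_smul, ← smul_mulVec, ← smul_mulVec, ← dotProduct_add,
      ← add_mulVec, h, dotProduct_zero]
  rw [← hA.dotProduct_mulVec_zero_iff]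
  have h1 : α • (star x ⬝ᵥ (A *ᵥ x)) = 0 :=
    ((add_eq_zero_iff_of_nonneg (smul_nonneg hα.le hA') (smul_nonneg hβ hB')).1 h0).1
  exact (smul_eq_zero.1 h1).resolve_left hα.ne'

lemma isAnnihilated_of_segment {c t α β : ℝ} {X Y : Matrix QIdx QIdx ℂ} (hX : X ∈ AP33)
    (hY : Y ∈ AP33) (hα : 0 < α) (hβ : 0 ≤ β)
    (h : α • X + β • Y = diagonal (fun m => (nu c t m : ℂ))) : IsAnnihilated c t X := by
  intro V hV hVρ
  have hU : symmetryBasis * V ∈ unitaryGroup QIdx ℂ := mul_mem symmetryBasis_mem_unitaryGroup hV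
  have hassoc : ∀ Z, symmetryBasis * (V * Z * Vᴴ) * symmetryBasisᴴ =
      symmetryBasis * V * Z * (symmetryBasis * V)ᴴ := fun Z => by
    simp only [conjTranspose_mul, Matrix.mul_assoc]
  rw [hassoc]
  refine mulVec_eq_zero_of_posSemidef_add (hX.2.2 _ hU) (hY.2.2 _ hU) hα hβ ?_
  have hlin : α • PT (symmetryBasis * V * X * (symmetryBasis * V)ᴴ) +
      β • PT (symmetryBasis * V * Y * (symmetryBasis * V)ᴴ) =
      PT (symmetryBasis * V * (α • X + β • Y) * (symmetryBasis * V)ᴴ) := by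
    rw [Matrix.mul_add, Matrix.add_mul, Matrix.mul_smul, Matrix.mul_smul, Matrix.smul_mul,
      Matrix.smul_mul]
    rfl
  rw [hlin, h, ← hassoc, hVρ, PT_symmetryBasis_nu_mulVec]

namespace IsAnnihilated

variable {c t : ℝ} {Z Z' : Matrix QIdx QIdx ℂ}

lemma sub (hZ : IsAnnihilated c t Z) (hZ' : IsAnnihilated c t Z') :
    IsAnnihilated c t (Z - Z') := by
  intro V hV hVρ
  have h := congrArg₂ (· - ·) (hZ V hV hVρ) (hZ' V hV hVρ)
  simp only [sub_zero, ← sub_mulVec] at h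
  rw [← h]
  simp only [Matrix.mul_sub, Matrix.sub_mul]
  rfl

lemma smul (hZ : IsAnnihilated c t Z) (a : ℂ) : IsAnnihilated c t (a • Z) := by
  intro V hV hVρ
  have h := congrArg (a • ·) (hZ V hV hVρ)
  simp only [smul_zero, ← smul_mulVec] at h
  rw [← h]
  simp only [Matrix.mul_smul, Matrix.smul_mul]
  rfl

lemma conj (hZ : IsAnnihilated c t Z) {V : Matrix QIdx QIdx ℂ} (hV : V ∈ unitaryGroup QIdx ℂ)
    (hVρ : V * diagonal (fun m => (nu c t m : ℂ)) * Vᴴ = diagonal (fun m => (nu c t m : ℂ))) :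
    IsAnnihilated c t (V * Z * Vᴴ) := by
  intro W hW hWρ
  have h := hZ (W * V) (mul_mem hW hV) (by
    rw [conjTranspose_mul, Matrix.mul_assoc W V, Matrix.mul_assoc W, ← Matrix.mul_assoc (V * _),
      hVρ, ← Matrix.mul_assoc, hWρ])
  rw [← h]
  simp only [conjTranspose_mul, Matrix.mul_assoc]

lemma conj_diagonal (hZ : IsAnnihilated c t Z) {v : QIdx → ℂ} (hv : ∀ m, v m * star (v m) = 1) :
    IsAnnihilated c t (Matrix.of fun p q => v p * star (v q) * Z p q) := by
  have h := hZ.conj (V := diagonal v) (by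
    rw [mem_unitaryGroup_iff, star_eq_conjTranspose, diagonal_conjTranspose, diagonal_mul_diagonal,
      ← diagonal_one]
    exact congrArg _ (funext hv)) (by
    rw [diagonal_conjTranspose, diagonal_mul_diagonal, diagonal_mul_diagonal]
    refine congrArg _ (funext fun m => ?_)
    rw [mul_right_comm, Pi.star_apply, hv, one_mul])
  convert h using 1
  ext p q
  simp [diagonal_conjTranspose, diagonal_mul, mul_diagonal]
  ring

lemma submatrix_perm (hZ : IsAnnihilated c t Z) (σ : Equiv.Perm QIdx)
    (hσ : ∀ m, nu c t (σ m) = nu c t m) : IsAnnihilated c t (Z.submatrix σ σ) := by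
  have hconj : ∀ A : Matrix QIdx QIdx ℂ, (1 : Matrix QIdx QIdx ℂ).submatrix σ id * A *
      ((1 : Matrix QIdx QIdx ℂ).submatrix σ id)ᴴ = A.submatrix σ σ := by
    intro A
    ext p q
    simp [mul_apply, one_apply]
  rw [← hconj]
  refine hZ.conj ?_ ?_
  · rw [mem_unitaryGroup_iff, star_eq_conjTranspose]
    simpa using hconj 1
  · rw [hconj, submatrix_diagonal_equiv]
    exact congrArg _ (funext fun m => by simp [hσ])

lemma submatrix_swap (hZ : IsAnnihilated c t Z) {a b : QIdx} (ha : a.1 ≠ 0) (hb : b.1 ≠ 0) :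
    IsAnnihilated c t (Z.submatrix (Equiv.swap a b) (Equiv.swap a b)) := by
  refine hZ.submatrix_perm _ fun m => ?_
  have h : ∀ p : QIdx, p.1 ≠ 0 → nu c t p = c := by
    rintro p hp
    have : p ≠ (0, 0) := fun h => hp (by rw [h])
    simp [nu, hp, this]
  rw [Equiv.swap_apply_def]
  split_ifs with hma hmb
  · rw [hma, h a ha, h b hb]
  · rw [hmb, h a ha, h b hb]
  · rfl

lemma single (hZ : IsAnnihilated c t Z) {m n : QIdx} (hmn : m ≠ n) :
    IsAnnihilated c t (Matrix.single m n (Z m n)) := by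
  have hflip : ∀ a : QIdx, ∀ b, Function.update (1 : QIdx → ℂ) a (-1) b *
      star (Function.update (1 : QIdx → ℂ) a (-1) b) = 1 := by
    intro a b
    by_cases hb : b = a <;> simp [hb]
  have hphase : ∀ b, Function.update (1 : QIdx → ℂ) m Complex.I b *
      star (Function.update (1 : QIdx → ℂ) m Complex.I b) = 1 := by
    intro b
    by_cases hb : b = m <;> simp [hb]
  have h1 := hZ.sub (hZ.conj_diagonal (hflip m))
  have h2 := h1.sub (h1.conj_diagonal (hflip n))
  have h3 := (h2.sub ((h2.conj_diagonal hphase).smul Complex.I)).smul (1 / 8)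
  convert h3 using 1
  ext p q
  have hI := Complex.I_mul_I
  rcases eq_or_ne p m with rfl | hpm
  · rcases eq_or_ne q n with rfl | hqn
    · simp [hmn, hmn.symm]
      linear_combination (1 / 2 * Z p q) * hI
    · rcases eq_or_ne q p with rfl | hqp
      · simp [hmn, hmn.symm]
      · simp [hmn, hqn, hqp, hqn.symm]
  · rcases eq_or_ne q m with rfl | hqm
    · rcases eq_or_ne p n with rfl | hpn
      · simp [hmn, hmn.symm]
        linear_combination (4 * Z p q) * hI
      · simp [hmn, hpm, hpn, hpm.symm]
    · simp [hpm, hqm, hpm.symm]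

lemma apply_eq_zero_of_coeff_ne_zero (hZ : IsAnnihilated c t Z) {m n : QIdx} (hmn : m ≠ n)
    (i j : Fin 3)
    (h : ∑ k, ![1, 1, (t : ℂ)] k * symmetryBasis (i, k) m * symmetryBasis (k, j) n ≠ 0) :
    Z m n = 0 := by
  have h1 := congrFun (hZ.single hmn 1 (one_mem _) (by simp)) (i, j)
  rw [Matrix.one_mul, conjTranspose_one, Matrix.mul_one, PT_symmetryBasis_single_mulVec] at h1
  exact (mul_eq_zero.1 h1).resolve_right h

/-- The off-diagonal entries of an annihilated matrix vanish, on or above the block diagonal. -/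
lemma apply_eq_zero (hZ : IsAnnihilated c t Z) (ht : t ≠ 0) {m n : QIdx} (hmn : m ≠ n)
    (hle : m.1 = 0 ∨ n.1 ≠ 0) : Z m n = 0 := by
  have hr : (((√2)⁻¹ : ℝ) : ℂ) ≠ 0 := by
    intro h
    simpa [h] using inv_sqrt_two_mul_self
  have ht' : (t : ℂ) ≠ 0 := by exact_mod_cast ht
  by_cases hm : m.1 = 0
  · have hmn' := hmn
    by_cases hn : n.1 = 0
    · obtain ⟨m1, m2⟩ := m
      obtain ⟨n1, n2⟩ := n
      obtain rfl : m1 = 0 := hm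
      obtain rfl : n1 = 0 := hn
      fin_cases m2 <;> fin_cases n2 <;> simp at hmn'
      · refine hZ.apply_eq_zero_of_coeff_ne_zero hmn 1 2 ?_
        simp [symmetryBasis, Fin.sum_univ_three, hr, ht']
      · refine hZ.apply_eq_zero_of_coeff_ne_zero hmn 0 2 ?_
        simp [symmetryBasis, Fin.sum_univ_three, hr, ht']
      · refine hZ.apply_eq_zero_of_coeff_ne_zero hmn 2 1 ?_
        simp [symmetryBasis, Fin.sum_univ_three, hr, ht']
      · refine hZ.apply_eq_zero_of_coeff_ne_zero hmn 0 1 ?_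
        simp [symmetryBasis, Fin.sum_univ_three, hr, ht']
      · refine hZ.apply_eq_zero_of_coeff_ne_zero hmn 2 0 ?_
        simp [symmetryBasis, Fin.sum_univ_three, hr, ht']
      · refine hZ.apply_eq_zero_of_coeff_ne_zero hmn 1 0 ?_
        simp [symmetryBasis, Fin.sum_univ_three, hr, ht']
    · have hsw := hZ.submatrix_swap hn (b := (1, 0)) (by simp)
      have hfix : Equiv.swap n (1, 0) m = m := Equiv.swap_apply_of_ne_of_ne hmn (by
        rintro rfl
        simp at hm)
      suffices h : (Z.submatrix (Equiv.swap n (1, 0)) (Equiv.swap n (1, 0))) m (1, 0) = 0 by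
        simpa [hfix] using h
      obtain ⟨m1, m2⟩ := m
      obtain rfl : m1 = 0 := hm
      fin_cases m2
      · exact hsw.apply_eq_zero_of_coeff_ne_zero (by simp) 0 0
          (by simp [symmetryBasis, Fin.sum_univ_three, hr, ht'])
      · exact hsw.apply_eq_zero_of_coeff_ne_zero (by simp) 2 1
          (by simp [symmetryBasis, Fin.sum_univ_three, hr, ht'])
      · exact hsw.apply_eq_zero_of_coeff_ne_zero (by simp) 2 0
          (by simp [symmetryBasis, Fin.sum_univ_three, hr, ht'])
  · have hn : n.1 ≠ 0 := hle.resolve_left hm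
    have hsw := hZ.submatrix_swap hm (b := (1, 0)) (by simp)
    set σ := Equiv.swap m (1, 0) with hσ
    have hσn : (σ n).1 ≠ 0 := by
      rw [hσ, Equiv.swap_apply_def]
      split_ifs <;> simp_all
    have hσn' : σ n ≠ (1, 0) := by
      intro h
      rw [hσ, Equiv.swap_apply_eq_iff, Equiv.swap_apply_right] at h
      exact hmn h.symm
    have hsw' := hsw.submatrix_swap hσn (b := (2, 0)) (by simp)
    have h := hsw'.apply_eq_zero_of_coeff_ne_zero (m := (1, 0)) (n := (2, 0)) (by simp) 1 0
      (by simp [symmetryBasis, Fin.sum_univ_three, hr, ht'])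
    have hfix : Equiv.swap (σ n) (2, 0) (1, 0) = (1, 0) :=
      Equiv.swap_apply_of_ne_of_ne hσn'.symm (by simp)
    rw [submatrix_apply, submatrix_apply, hfix, Equiv.swap_apply_right, hσ,
      Equiv.swap_apply_right, Equiv.swap_apply_self] at h
    exact h

lemma eq_diagonal (hZ : IsAnnihilated c t Z) (ht : t ≠ 0) (hherm : Z.IsHermitian) :
    Z = diagonal fun m => Z m m := by
  ext m n
  rcases eq_or_ne m n with rfl | hmn
  · simp
  rw [diagonal_apply_ne _ hmn]
  by_cases h : m.1 = 0 ∨ n.1 ≠ 0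
  · exact hZ.apply_eq_zero ht hmn h
  · push Not at h
    rw [← hherm.apply, hZ.apply_eq_zero ht hmn.symm (Or.inl h.2), star_zero]

/-- The diagonal equations. -/
lemma diagonal_equation {z : QIdx → ℂ} (hZ : IsAnnihilated c t (diagonal z)) :
    z (1, 0) + t * z (1, 1) + 2 * z (2, 0) = z (0, 0) + t * z (0, 1) ∧
    z (1, 0) + t * z (1, 2) + 2 * z (2, 1) = z (0, 0) + t * z (0, 2) ∧
    z (1, 1) + z (1, 2) + 2 * t * z (2, 2) = z (0, 1) + z (0, 2) := by
  have h0 := hZ 1 (one_mem _) (by simp)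
  have hr := inv_sqrt_two_mul_self
  have h : ∀ i j, _ := fun i j =>
    (PT_symmetryBasis_diagonal_mulVec t z i j).symm.trans (by simpa using congrFun h0 (i, j))
  have e0 := h 0 0
  have e1 := h 1 1
  have e2 := h 2 2
  simp only [symmetryBasis, Fintype.sum_prod_type, Fin.sum_univ_three] at e0 e1 e2
  generalize (((√2)⁻¹ : ℝ) : ℂ) = r at hr e0 e1 e2
  simp [mul_assoc, hr] at e0 e1 e2
  refine ⟨?_, ?_, ?_⟩
  · linear_combination 2 * e0
  · linear_combination 2 * e1
  · linear_combination 2 * e2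

lemma diagonal_apply_eq_of_ne {z : QIdx → ℂ} (hZ : IsAnnihilated c t (diagonal z)) {m : QIdx}
    (hm : m.1 ≠ 0) : z m = z (1, 0) := by
  by_cases hm' : m = (1, 0)
  · rw [hm']
  have h1 := hZ.submatrix_swap hm (b := (1, 2)) (by simp)
  have h2 := h1.submatrix_swap (a := (1, 0)) (b := (1, 2)) (by simp) (by simp)
  rw [submatrix_diagonal_equiv] at h1
  rw [submatrix_diagonal_equiv, submatrix_diagonal_equiv] at h2
  have e1 := h1.diagonal_equation.1
  have e2 := h2.diagonal_equation.1
  have s : ∀ a : QIdx, a ≠ (1, 0) → a ≠ (1, 2) → Equiv.swap ((1, 0) : QIdx) (1, 2) a = a :=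
    fun a => Equiv.swap_apply_of_ne_of_ne
  simp only [Function.comp_apply, Equiv.swap_apply_left, Equiv.swap_apply_right,
    s (0, 0) (by simp) (by simp), s (0, 1) (by simp) (by simp), s (1, 1) (by simp) (by simp),
    s (2, 0) (by simp) (by simp)] at e1 e2
  rw [Equiv.swap_apply_of_ne_of_ne (a := m) (x := (1, 0)) (Ne.symm hm') (by simp)] at e1
  linear_combination e2 - e1

lemma eq_diagonal_nu {X : Matrix QIdx QIdx ℂ} (hX : IsAnnihilated c t X) (ht : t ≠ 0)
    (hherm : X.IsHermitian) (htrace : X.trace = 1) (htr : c * (11 + 2 * t - t ^ 2) = 1) :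
    X = diagonal fun m => (nu c t m : ℂ) := by
  have hd := hX.eq_diagonal ht hherm
  set z : QIdx → ℂ := fun m => X m m with hz
  rw [hd] at hX htrace ⊢
  have ht' : (t : ℂ) ≠ 0 := by exact_mod_cast ht
  have htr' : (c : ℂ) * (11 + 2 * t - t ^ 2) = 1 := by exact_mod_cast htr
  have hcst : ∀ m : QIdx, m.1 ≠ 0 → z m = z (1, 0) := fun m hm => hX.diagonal_apply_eq_of_ne hm
  obtain ⟨e0, e1, e2⟩ := hX.diagonal_equation
  rw [trace_diagonal] at htrace
  simp only [Fintype.sum_prod_type, Fin.sum_univ_three] at htrace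
  rw [hcst (1, 1) (by simp), hcst (1, 2) (by simp), hcst (2, 0) (by simp), hcst (2, 1) (by simp),
    hcst (2, 2) (by simp)] at htrace
  rw [hcst (1, 1) (by simp), hcst (2, 0) (by simp)] at e0
  rw [hcst (1, 2) (by simp), hcst (2, 1) (by simp)] at e1
  rw [hcst (1, 1) (by simp), hcst (1, 2) (by simp), hcst (2, 2) (by simp)] at e2
  have h12 : z (0, 1) = z (0, 2) := mul_left_cancel₀ ht' (by linear_combination e1 - e0)
  have h1 : z (0, 1) = z (1, 0) * (1 + t) := by linear_combination h12 / 2 - e2 / 2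
  have h0 : z (0, 0) = z (1, 0) * (3 - t ^ 2) := by linear_combination -e0 - t * h1
  have hne : (11 + 2 * t - t ^ 2 : ℂ) ≠ 0 := right_ne_zero_of_mul_eq_one htr'
  have hc : z (1, 0) = c := mul_right_cancel₀ hne (by
    linear_combination htrace - htr' - h0 - 2 * h1 + h12)
  congr 1
  ext ⟨i, j⟩
  by_cases hi : i = 0
  · subst hi
    fin_cases j
    · simp [nu, h0, hc]
    · simp [nu, h1, hc]
    · simp [nu, ← h12, h1, hc]
  · rw [hcst (i, j) hi, hc]
    simp [nu, hi]

end IsAnnihilated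

theorem diagonal_nu_mem_extremePoints {c t : ℝ} (hc : 0 ≤ c) (ht0 : 0 < t) (ht1 : t ≤ 1)
    (htr : c * (11 + 2 * t - t ^ 2) = 1) :
    (diagonal (fun m => (nu c t m : ℂ)) : Matrix QIdx QIdx ℂ) ∈ Set.extremePoints ℝ AP33 := by
  refine mem_extremePoints_iff_left.2 ⟨diagonal_nu_mem_AP33 hc ht0.le ht1 htr, ?_⟩
  rintro X hX Y hY ⟨α, β, hα, hβ, -, h⟩
  exact (isAnnihilated_of_segment hX hY hα hβ.le h).eq_diagonal_nu ht0.ne' hX.1.isHermitian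
    hX.2.1 htr

/-- for 1/12 < c < 1/11, the state diag(a, b, b, c, c, c, c, c, c) with
a = 1 − 10c + 2√(12c² − c) and b = 2c − √(12c² − c) is extreme in AP_{3,3}. -/
theorem nu126_extreme (c : ℝ) (h1 : 1 / 12 < c) (h2 : c < 1 / 11) :
    diag9 ![1 - 10 * c + 2 * Real.sqrt (12 * c ^ 2 - c),
        2 * c - Real.sqrt (12 * c ^ 2 - c), 2 * c - Real.sqrt (12 * c ^ 2 - c),
        c, c, c, c, c, c]
      ∈ Set.extremePoints ℝ AP33 := by
  have hc : 0 < c := by linarith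
  have hpos : 0 < 12 * c ^ 2 - c := by nlinarith
  set s := Real.sqrt (12 * c ^ 2 - c) with hs
  have hs2 : s ^ 2 = 12 * c ^ 2 - c := Real.sq_sqrt hpos.le
  have hs0 : 0 < s := Real.sqrt_pos.2 hpos
  have hsc : s < c := by
    refine lt_of_pow_lt_pow_left₀ 2 hc.le ?_
    nlinarith
  have ht0 : 0 < 1 - s / c := by
    rw [sub_pos, div_lt_one hc]
    exact hsc
  have ht1 : 1 - s / c ≤ 1 := by
    have : 0 ≤ s / c := by positivity
    linarith
  have hb : c * (1 + (1 - s / c)) = 2 * c - s := by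
    field_simp
    ring
  have ha : c * (3 - (1 - s / c) ^ 2) = 1 - 10 * c + 2 * s := by
    field_simp
    linear_combination -hs2
  have htr : c * (11 + 2 * (1 - s / c) - (1 - s / c) ^ 2) = 1 := by
    linear_combination ha + 2 * hb
  have key := diagonal_nu_mem_extremePoints hc.le ht0 ht1 htr
  convert key using 1
  unfold diag9
  congr 1
  ext ⟨i, j⟩
  rw [Complex.ofReal_inj]
  fin_cases i <;> fin_cases j <;> simp [nu, ha, hb, finProdFinEquiv, finCongr]
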